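/- Let u, v ∈ H^m(𝕋^d) ∩ L^∞(𝕋^d) and let α, β be multi-indices with |α| + |β| = m. Then there is a constant C > 0 depending only on m and d such that ‖(∂^α u)(∂^β v)‖_{L²} ≤ C (‖u‖_{L^∞} ‖v‖_{H^m} + ‖u‖_{H^m} ‖v‖_{L^∞}). -/

import Mathlib

open MeasureTheory

/-- `M n = n!/(n+1)^2`. -/
noncomputable def Mseq (n : ℕ) : ℝ := (n.factorial : ℝ) / ((n : ℝ) + 1) ^ 2

/-- Partial derivative `∂_j f`. -/
noncomputable def pderiv' {d : ℕ} (j : Fin d) (f : (Fin d → ℝ) → ℝ) : (Fin d → ℝ) → ℝ :=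
  fun x => fderiv ℝ f x (Pi.single j 1)

/-- Multi-index derivative `∂^α f`. -/
noncomputable def mderiv {d : ℕ} (α : Fin d → ℕ) (f : (Fin d → ℝ) → ℝ) : (Fin d → ℝ) → ℝ :=
  (List.finRange d).foldr (fun j g => (pderiv' j)^[α j] g) f

/-- `ℤ^d`-periodicity, modelling functions on the torus `𝕋^d`. -/
def TorusPeriodic {d : ℕ} (f : (Fin d → ℝ) → ℝ) : Prop :=
  ∀ (x : Fin d → ℝ) (v : Fin d → ℤ), f (fun i => x i + (v i : ℝ)) = f x

/-- `L²` norm on the torus (integral over a fundamental domain). -/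
noncomputable def L2Norm (d : ℕ) (f : (Fin d → ℝ) → ℝ) : ℝ :=
  Real.sqrt (∫ x in Set.Icc (0 : Fin d → ℝ) 1, (f x) ^ 2)

/-- `L²` inner product on the torus. -/
noncomputable def L2Inner (d : ℕ) (f g : (Fin d → ℝ) → ℝ) : ℝ :=
  ∫ x in Set.Icc (0 : Fin d → ℝ) 1, f x * g x

/-- `L^∞` norm. -/
noncomputable def LinfNorm (d : ℕ) (f : (Fin d → ℝ) → ℝ) : ℝ := ⨆ x, |f x|

/-- Multi-indices of length `≤ k`. -/
noncomputable def multiIndices (d k : ℕ) : Finset (Fin d → ℕ) :=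
  (Finset.Iic (fun _ => k : Fin d → ℕ)).filter (fun α => ∑ i, α i ≤ k)

/-- Sobolev `H^k` norm on the torus. -/
noncomputable def HkNorm (d k : ℕ) (f : (Fin d → ℝ) → ℝ) : ℝ :=
  Real.sqrt (∑ α ∈ multiIndices d k, (L2Norm d (mderiv α f)) ^ 2)


/-- smooth and periodic -/
def SP {d : ℕ} (f : (Fin d → ℝ) → ℝ) : Prop := ContDiff ℝ (⊤ : ℕ∞) f ∧ TorusPeriodic f

lemma pd_smooth {d : ℕ} (j : Fin d) {f : (Fin d → ℝ) → ℝ} (hf : ContDiff ℝ (⊤ : ℕ∞) f) :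
    ContDiff ℝ (⊤ : ℕ∞) (pderiv' j f) := by
  unfold pderiv'
  have h : ContDiff ℝ (⊤ : ℕ∞) (fderiv ℝ f) := hf.fderiv_right (m := (⊤ : ℕ∞)) (by simp)
  exact h.clm_apply contDiff_const

lemma pd_SP {d : ℕ} (j : Fin d) {f : (Fin d → ℝ) → ℝ} (hf : SP f) : SP (pderiv' j f) := by
  refine ⟨pd_smooth j hf.1, ?_⟩
  intro x v
  unfold pderiv'
  have h : (fun y : Fin d → ℝ => f (y + fun i => (v i : ℝ))) = f := by
    funext y
    exact hf.2 y v
  have h2 := fderiv_comp_add_right (𝕜 := ℝ) (f := f) (x := x) (fun i => (v i : ℝ))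
  rw [h] at h2
  rw [h2]
  rfl

lemma pd_comm {d : ℕ} (i j : Fin d) {f : (Fin d → ℝ) → ℝ} (hf : ContDiff ℝ (⊤ : ℕ∞) f) :
    pderiv' i (pderiv' j f) = pderiv' j (pderiv' i f) := by
  funext x
  have h : ContDiff ℝ (⊤ : ℕ∞) (fderiv ℝ f) := hf.fderiv_right (m := (⊤ : ℕ∞)) (by simp)
  have hd : DifferentiableAt ℝ (fderiv ℝ f) x := (h.differentiable (by simp)) x
  have key : ∀ a b : Fin d, pderiv' a (pderiv' b f) x
      = fderiv ℝ (fderiv ℝ f) x (Pi.single a 1) (Pi.single b 1) := by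
    intro a b
    unfold pderiv'
    rw [fderiv_clm_apply hd (differentiableAt_const _)]
    simp
  rw [key, key]
  have hs : IsSymmSndFDerivAt ℝ f x :=
    (hf.contDiffAt).isSymmSndFDerivAt (by
      simp only [minSmoothness_of_isRCLikeNormedField]
      exact WithTop.coe_le_coe.2 (le_top : (2 : ℕ∞) ≤ ⊤))
  exact hs.eq _ _

lemma pd_const_mul {d : ℕ} (j : Fin d) (c : ℝ) {f : (Fin d → ℝ) → ℝ}
    (hf : ContDiff ℝ (⊤ : ℕ∞) f) :
    pderiv' j (fun x => c * f x) = fun x => c * pderiv' j f x := by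
  funext x
  unfold pderiv'
  rw [fderiv_const_mul ((hf.differentiable (by simp)) x)]
  simp

/-- derivative along a word -/
noncomputable def Dw {d : ℕ} (l : List (Fin d)) (f : (Fin d → ℝ) → ℝ) : (Fin d → ℝ) → ℝ :=
  l.foldr pderiv' f

lemma Dw_cons {d : ℕ} (j : Fin d) (l : List (Fin d)) (f : (Fin d → ℝ) → ℝ) :
    Dw (j :: l) f = pderiv' j (Dw l f) := rfl

lemma Dw_SP {d : ℕ} (l : List (Fin d)) {f : (Fin d → ℝ) → ℝ} (hf : SP f) : SP (Dw l f) := by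
  induction l with
  | nil => exact hf
  | cons j l ih => exact pd_SP j ih

lemma Dw_const_mul {d : ℕ} (l : List (Fin d)) (c : ℝ) {f : (Fin d → ℝ) → ℝ} (hf : SP f) :
    Dw l (fun x => c * f x) = fun x => c * Dw l f x := by
  induction l with
  | nil => rfl
  | cons j l ih => rw [Dw_cons, ih, pd_const_mul j c (Dw_SP l hf).1]; rfl

lemma Dw_perm {d : ℕ} {l l' : List (Fin d)} (h : l.Perm l') {f : (Fin d → ℝ) → ℝ} (hf : SP f) :
    Dw l f = Dw l' f := by
  induction h with
  | nil => rfl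
  | cons x _ ih => rw [Dw_cons, Dw_cons, ih]
  | swap x y l => exact pd_comm _ _ (Dw_SP l hf).1
  | trans _ _ ih1 ih2 => exact ih1.trans ih2

/-- the word of a multi-index -/
def wordOf {d : ℕ} (α : Fin d → ℕ) : List (Fin d) :=
  (List.finRange d).flatMap (fun j => List.replicate (α j) j)

lemma Dw_replicate {d : ℕ} (j : Fin d) (n : ℕ) (f : (Fin d → ℝ) → ℝ) :
    Dw (List.replicate n j) f = (pderiv' j)^[n] f := by
  induction n with
  | zero => rfl
  | succ n ih => rw [List.replicate_succ, Dw_cons, ih, Function.iterate_succ_apply']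

lemma mderiv_eq {d : ℕ} (α : Fin d → ℕ) (f : (Fin d → ℝ) → ℝ) : mderiv α f = Dw (wordOf α) f := by
  unfold mderiv wordOf
  induction List.finRange d with
  | nil => rfl
  | cons j l ih =>
    rw [List.foldr_cons, ih, ← Dw_replicate, List.flatMap_cons]
    simp [Dw, List.foldr_append]

lemma wordOf_length {d : ℕ} (α : Fin d → ℕ) : (wordOf α).length = ∑ i, α i := by
  simp [wordOf, List.length_flatMap, Fin.sum_univ_def]

lemma count_wordOf {d : ℕ} (α : Fin d → ℕ) (i : Fin d) : (wordOf α).count i = α i := by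
  unfold wordOf
  rw [List.count_flatMap]
  have : (List.map (List.count i ∘ fun j => List.replicate (α j) j) (List.finRange d)).sum
     = ∑ j, if j = i then α j else 0 := by
    rw [Fin.sum_univ_def]
    congr 2
    funext j
    simp [List.count_replicate]
  rw [this]
  simp

lemma Dw_eq_mderiv {d : ℕ} (l : List (Fin d)) {f : (Fin d → ℝ) → ℝ} (hf : SP f) :
    Dw l f = mderiv (fun i => l.count i) f := by
  rw [mderiv_eq]
  refine Dw_perm ?_ hf
  rw [List.perm_iff_count]
  intro a
  rw [count_wordOf]

lemma L2_le_Hk {d k : ℕ} (α : Fin d → ℕ) (h : ∑ i, α i ≤ k) (f : (Fin d → ℝ) → ℝ) :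
    L2Norm d (mderiv α f) ^ 2 ≤ HkNorm d k f ^ 2 := by
  unfold HkNorm
  rw [Real.sq_sqrt (Finset.sum_nonneg fun _ _ => sq_nonneg _)]
  refine Finset.single_le_sum (f := fun α => L2Norm d (mderiv α f) ^ 2)
    (fun _ _ => sq_nonneg _) ?_
  simp only [multiIndices, Finset.mem_filter, Finset.mem_Iic]
  refine ⟨fun i => ?_, h⟩
  exact (Finset.single_le_sum (fun _ _ => Nat.zero_le _) (Finset.mem_univ i)).trans h

lemma int_cont {d : ℕ} {f : (Fin d → ℝ) → ℝ} (hf : Continuous f) :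
    IntegrableOn f (Set.Icc (0 : Fin d → ℝ) 1) :=
  hf.continuousOn.integrableOn_compact isCompact_Icc

lemma L2_sq {d : ℕ} (f : (Fin d → ℝ) → ℝ) :
    L2Norm d f ^ 2 = ∫ x in Set.Icc (0 : Fin d → ℝ) 1, (f x) ^ 2 := by
  unfold L2Norm
  rw [Real.sq_sqrt (integral_nonneg fun _ => sq_nonneg _)]

lemma SP_bdd {d : ℕ} {f : (Fin d → ℝ) → ℝ} (hf : SP f) : BddAbove (Set.range fun x => |f x|) := by
  have hc : ContinuousOn (fun x => |f x|) (Set.Icc (0 : Fin d → ℝ) 1) :=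
    hf.1.continuous.abs.continuousOn
  obtain ⟨C, hC⟩ := isCompact_Icc.bddAbove_image hc
  refine ⟨C, ?_⟩
  rintro _ ⟨x, rfl⟩
  have h := hf.2 x (fun i => - ⌊x i⌋)
  simp only
  rw [← h]
  apply hC
  refine ⟨_, ⟨fun i => ?_, fun i => ?_⟩, rfl⟩
  · simpa using Int.floor_le (x i)
  · have := (Int.lt_floor_add_one (x i)).le
    simp; linarith

lemma le_Linf {d : ℕ} {f : (Fin d → ℝ) → ℝ} (hf : SP f) (x) : |f x| ≤ LinfNorm d f :=
  le_ciSup (SP_bdd hf) x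

lemma int_pd {d : ℕ} (j : Fin d) {F : (Fin d → ℝ) → ℝ} (hF : Differentiable ℝ F)
    (hper : TorusPeriodic F) (hc : Continuous (pderiv' j F)) :
    ∫ x in Set.Icc (0 : Fin d → ℝ) 1, pderiv' j F x = 0 := by
  obtain _ | n := d
  · exact j.elim0
  have := integral_divergence_of_hasFDerivAt_off_countable' (E := ℝ) (n := n) (0 : Fin (n+1) → ℝ) 1
    (fun i => zero_le_one)
    (fun i => if i = j then F else 0) (fun i => if i = j then fderiv ℝ F else 0) ∅
    Set.countable_empty ?_ ?_ ?_
  · have e : ∀ x : Fin (n+1) → ℝ, (∑ i, (if i = j then fderiv ℝ F else 0) x (Pi.single i 1))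
        = pderiv' j F x := by
      intro x
      rw [Finset.sum_eq_single j]
      · simp [pderiv']
      · intro b _ hb; simp [hb]
      · simp
    simp only [e] at this
    rw [this]
    refine Finset.sum_eq_zero fun i _ => ?_
    by_cases hi : i = j
    · subst hi
      simp only [if_true]
      rw [sub_eq_zero]
      congr 1
      funext y
      have h := hper (i.insertNth ((0 : Fin (n+1) → ℝ) i) y) (Pi.single i 1)
      rw [← h]
      congr 1
      funext k
      refine Fin.succAboveCases i ?_ (fun k => ?_) k
      · simp
      · simp
    · simp [hi]
  · intro i
    by_cases hi : i = j
    · simp only [hi, if_true]; exact hF.continuous.continuousOn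
    · simp only [hi, if_false]; exact continuousOn_const
  · intro x _ i
    by_cases hi : i = j
    · simp only [hi, if_true]; exact (hF x).hasFDerivAt
    · simp only [hi, if_false]; exact hasFDerivAt_const _ _
  · have e : ∀ x : Fin (n+1) → ℝ, (∑ i, (if i = j then fderiv ℝ F else 0) x (Pi.single i 1))
        = pderiv' j F x := by
      intro x
      rw [Finset.sum_eq_single j]
      · simp [pderiv']
      · intro b _ hb; simp [hb]
      · simp
    simp only [e]
    exact int_cont hc

lemma hasDerivAt_h {q : ℝ} (hq : 0 < q) (t : ℝ) :
    HasDerivAt (fun t : ℝ => t * |t| ^ q) ((q + 1) * |t| ^ q) t := by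
  have h := hasDerivAt_abs_rpow t (p := q + 1) (by linarith)
  rcases lt_trichotomy t 0 with ht | ht | ht
  · have h2 := h.neg
    have he : (fun t : ℝ => t * |t| ^ q) =ᶠ[nhds t] (fun x => -|x| ^ (q + 1)) := by
      filter_upwards [gt_mem_nhds ht] with x hx
      rw [Real.rpow_add_one (abs_pos.2 hx.ne).ne', abs_of_neg hx]; ring
    refine (h2.congr_of_eventuallyEq he).congr_deriv ?_
    have : |t| ^ q = |t| ^ (q + 1 - 2) * |t| := by
      rw [← Real.rpow_add_one (abs_pos.2 ht.ne).ne']; ring_nf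
    rw [this, abs_of_neg ht]; ring
  · subst ht
    rw [abs_zero, Real.zero_rpow hq.ne', mul_zero, hasDerivAt_iff_tendsto_slope_zero]
    simp only [zero_add, abs_zero, zero_mul, sub_zero, smul_eq_mul]
    have : Filter.Tendsto (fun t : ℝ => |t| ^ q) (nhdsWithin 0 {0}ᶜ) (nhds 0) := by
      have : Continuous (fun t : ℝ => |t| ^ q) :=
        continuous_abs.rpow_const (fun _ => Or.inr hq.le)
      have := (this.tendsto 0).mono_left (nhdsWithin_le_nhds (s := {0}ᶜ))
      simpa [Real.zero_rpow hq.ne'] using this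
    refine this.congr' ?_
    filter_upwards [self_mem_nhdsWithin] with x hx
    field_simp [show x ≠ 0 from hx]
  · have he : (fun t : ℝ => t * |t| ^ q) =ᶠ[nhds t] (fun x => |x| ^ (q + 1)) := by
      filter_upwards [lt_mem_nhds ht] with x hx
      rw [Real.rpow_add_one (abs_pos.2 hx.ne').ne', abs_of_pos hx]; ring
    refine (h.congr_of_eventuallyEq he).congr_deriv ?_
    have : |t| ^ q = |t| ^ (q + 1 - 2) * |t| := by
      rw [← Real.rpow_add_one (abs_pos.2 ht.ne').ne']; ring_nf
    rw [this, abs_of_pos ht]; ring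

lemma cont_abs_rpow {d : ℕ} {f : (Fin d → ℝ) → ℝ} (hf : SP f) {q : ℝ} (hq : 0 ≤ q) :
    Continuous fun x => |f x| ^ q :=
  hf.1.continuous.abs.rpow_const (fun _ => Or.inr hq)

lemma ibp {d : ℕ} (j : Fin d) {g : (Fin d → ℝ) → ℝ} (hg : SP g) {q : ℝ} (hq : 0 < q) :
    ∫ x in Set.Icc (0 : Fin d → ℝ) 1, |pderiv' j g x| ^ (q + 2) ≤
    ∫ x in Set.Icc (0 : Fin d → ℝ) 1,
      (q + 1) * |g x| * |pderiv' j g x| ^ q * |pderiv' j (pderiv' j g) x| := by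
  have hG := pd_SP j hg
  have hGG := pd_SP j hG
  set G := pderiv' j g with hGdef
  set F : (Fin d → ℝ) → ℝ := fun x => g x * (G x * |G x| ^ q) with hFdef
  have hFd : ∀ x, HasFDerivAt F
      (g x • (((q + 1) * |G x| ^ q) • fderiv ℝ G x) + (G x * |G x| ^ q) • fderiv ℝ g x) x := by
    intro x
    have h1 := ((hg.1.differentiable (by simp)) x).hasFDerivAt
    have h2 := ((hG.1.differentiable (by simp)) x).hasFDerivAt
    exact h1.mul ((hasDerivAt_h hq (G x)).comp_hasFDerivAt x h2)
  have hp : pderiv' j F = fun x => |G x| ^ (q + 2)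
      + (q + 1) * g x * |G x| ^ q * pderiv' j G x := by
    funext x
    have : |G x| ^ (q + 2) = G x * |G x| ^ q * G x := by
      by_cases h0 : G x = 0
      · rw [h0]; simp [Real.zero_rpow (by linarith : q + 2 ≠ 0)]
      · rw [Real.rpow_add (abs_pos.2 h0), Real.rpow_two, sq_abs]; ring
    rw [this, pderiv', (hFd x).fderiv]
    simp only [add_apply, smul_apply, smul_eq_mul]
    have e1 : G x = fderiv ℝ g x (Pi.single j 1) := rfl
    rw [← e1]
    simp only [pderiv']
    ring
  have c1 : Continuous fun x => |G x| ^ (q + 2) := cont_abs_rpow hG (by linarith)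
  have c0 : Continuous fun x => |G x| ^ q := cont_abs_rpow hG hq.le
  have cg := hg.1.continuous
  have cGG := hGG.1.continuous
  have c2 : Continuous fun x => (q + 1) * g x * |G x| ^ q * pderiv' j G x := by fun_prop
  have h0 := int_pd j (F := F) (fun x => (hFd x).differentiableAt) ?_ ?_
  · rw [hp, integral_add (int_cont c1) (int_cont c2)] at h0
    have : ∫ x in Set.Icc (0 : Fin d → ℝ) 1, |G x| ^ (q + 2)
      = ∫ x in Set.Icc (0 : Fin d → ℝ) 1, -((q + 1) * g x * |G x| ^ q * pderiv' j G x) := by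
      rw [integral_neg]; linarith
    rw [this]
    refine integral_mono (int_cont c2).neg (int_cont (by fun_prop)) fun x => ?_
    refine (neg_le_abs _).trans (le_of_eq ?_)
    simp only [abs_mul]
    rw [abs_of_pos (by linarith : 0 < q + 1), abs_of_nonneg (by positivity : 0 ≤ |G x| ^ q)]
  · intro x v
    simp only [hFdef, hg.2 x v, hG.2 x v]
  · rw [hp]; exact c1.add c2

lemma young3 {w1 w2 w3 : ℝ} (h1 : 0 ≤ w1) (h2 : 0 ≤ w2) (h3 : 0 < w3) (hs : w1 + w2 + w3 = 1)
    {M ε : ℝ} (hM : 0 < M) (hε : 0 < ε) :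
    ∃ K : ℝ, 0 < K ∧ ∀ x y z : ℝ, 0 ≤ x → 0 ≤ y → 0 ≤ z →
      M * (x ^ w1 * y ^ w2 * z ^ w3) ≤ ε * x + y / 2 + K * z := by
  set b : ℝ := M / (ε ^ w1 * (1 / 2 : ℝ) ^ w2) with hb
  have hbp : 0 < b := by positivity
  refine ⟨b ^ (1 / w3), by positivity, fun x y z hx hy hz => ?_⟩
  have hK : (b ^ (1 / w3)) ^ w3 = b := by
    rw [← Real.rpow_mul hbp.le]; field_simp; simp
  have hKp : 0 < b ^ (1 / w3) := by positivity
  generalize b ^ (1 / w3) = K at hK hKp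
  have h := Real.geom_mean_le_arith_mean3_weighted h1 h2 h3.le
    (mul_nonneg hε.le hx) (mul_nonneg (by norm_num : (0 : ℝ) ≤ 1 / 2) hy)
    (mul_nonneg hKp.le hz) hs
  rw [Real.mul_rpow hε.le hx, Real.mul_rpow (by norm_num) hy, Real.mul_rpow hKp.le hz, hK] at h
  have e : M * (x ^ w1 * y ^ w2 * z ^ w3)
    = ε ^ w1 * x ^ w1 * ((1 / 2 : ℝ) ^ w2 * y ^ w2) * (b * z ^ w3) := by
    rw [hb]; field_simp
  rw [e]
  refine h.trans ?_
  have a1 : w1 * (ε * x) ≤ 1 * (ε * x) :=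
    mul_le_mul_of_nonneg_right (by linarith) (by positivity)
  have a2 : w2 * (1 / 2 * y) ≤ 1 * (1 / 2 * y) :=
    mul_le_mul_of_nonneg_right (by linarith) (by positivity)
  have a3 : w3 * (K * z) ≤ 1 * (K * z) :=
    mul_le_mul_of_nonneg_right (by linarith) (by positivity)
  linarith

/-- integral of a power -/
noncomputable def Jp {d : ℕ} (p : ℝ) (f : (Fin d → ℝ) → ℝ) : ℝ :=
  ∫ x in Set.Icc (0 : Fin d → ℝ) 1, |f x| ^ p

lemma Jp_nonneg {d : ℕ} (p : ℝ) (f : (Fin d → ℝ) → ℝ) : 0 ≤ Jp p f :=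
  integral_nonneg fun _ => Real.rpow_nonneg (abs_nonneg _) _

lemma stepA {p s r ε : ℝ} (hp : 2 < p) (hs : 0 < s) (hr : 0 < r)
    (h : 1 / s + (p - 2) / p + 1 / r = 1) (hε : 0 < ε) (d : ℕ) :
    ∃ K : ℝ, 0 < K ∧ ∀ (j : Fin d) (g : (Fin d → ℝ) → ℝ), SP g →
      Jp p (pderiv' j g) ≤ 2 * ε * Jp s g + 2 * K * Jp r (pderiv' j (pderiv' j g)) := by
  obtain ⟨K, hK, hY⟩ := young3 (w1 := 1 / s) (w2 := (p - 2) / p) (w3 := 1 / r)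
    (by positivity) (div_nonneg (by linarith) (by linarith)) (by positivity) h
    (M := p - 1) (by linarith) hε
  refine ⟨K, hK, fun j g hg => ?_⟩
  have hG := pd_SP j hg
  have hGG := pd_SP j hG
  have c1 := cont_abs_rpow hg hs.le
  have c2 := cont_abs_rpow hG (by linarith : 0 ≤ p)
  have c2' := cont_abs_rpow hG (by linarith : 0 ≤ p - 2)
  have c3 := cont_abs_rpow hGG hr.le
  have b1 := hg.1.continuous
  have b3 := hGG.1.continuous
  have hi := ibp j hg (q := p - 2) (by linarith)
  rw [show p - 2 + 2 = p by ring, show p - 2 + 1 = p - 1 by ring] at hi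
  have h2 : ∫ x in Set.Icc (0 : Fin d → ℝ) 1,
      (p - 1) * |g x| * |pderiv' j g x| ^ (p - 2) * |pderiv' j (pderiv' j g) x|
      ≤ ∫ x in Set.Icc (0 : Fin d → ℝ) 1, (ε * |g x| ^ s + |pderiv' j g x| ^ p / 2
        + K * |pderiv' j (pderiv' j g) x| ^ r) := by
    refine integral_mono (int_cont (by fun_prop)) (int_cont (by fun_prop)) fun x => ?_
    have := hY (|g x| ^ s) (|pderiv' j g x| ^ p) (|pderiv' j (pderiv' j g) x| ^ r)
      (by positivity) (by positivity) (by positivity)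
    rw [← Real.rpow_mul (abs_nonneg _), ← Real.rpow_mul (abs_nonneg _),
      ← Real.rpow_mul (abs_nonneg _), mul_one_div_cancel hs.ne', mul_one_div_cancel hr.ne',
      mul_div_cancel₀ _ (by linarith : p ≠ 0), Real.rpow_one, Real.rpow_one] at this
    simp only
    linarith
  rw [integral_add (int_cont (by fun_prop)) (int_cont (by fun_prop)),
    integral_add (int_cont (by fun_prop)) (int_cont (by fun_prop)),
    integral_const_mul, integral_const_mul, integral_div] at h2
  unfold Jp
  linarith

lemma stepB {p r : ℝ} (hp : 2 < p) (hr : 0 < r)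
    (h : (p - 2) / p + 1 / r = 1) (d : ℕ) :
    ∃ K : ℝ, 0 < K ∧ ∀ (j : Fin d) (g : (Fin d → ℝ) → ℝ), SP g → (∀ x, |g x| ≤ 1) →
      Jp p (pderiv' j g) ≤ 2 * K * Jp r (pderiv' j (pderiv' j g)) := by
  obtain ⟨K, hK, hY⟩ := young3 (w1 := 0) (w2 := (p - 2) / p) (w3 := 1 / r)
    le_rfl (div_nonneg (by linarith) (by linarith)) (by positivity) (by linarith)
    (M := p - 1) (ε := 1) (by linarith) one_pos
  refine ⟨K, hK, fun j g hg hb => ?_⟩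
  have hG := pd_SP j hg
  have hGG := pd_SP j hG
  have c2 := cont_abs_rpow hG (by linarith : 0 ≤ p)
  have c2' := cont_abs_rpow hG (by linarith : 0 ≤ p - 2)
  have c3 := cont_abs_rpow hGG hr.le
  have b1 := hg.1.continuous
  have b3 := hGG.1.continuous
  have hi := ibp j hg (q := p - 2) (by linarith)
  rw [show p - 2 + 2 = p by ring, show p - 2 + 1 = p - 1 by ring] at hi
  have h2 : ∫ x in Set.Icc (0 : Fin d → ℝ) 1,
      (p - 1) * |g x| * |pderiv' j g x| ^ (p - 2) * |pderiv' j (pderiv' j g) x|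
      ≤ ∫ x in Set.Icc (0 : Fin d → ℝ) 1, (|pderiv' j g x| ^ p / 2
        + K * |pderiv' j (pderiv' j g) x| ^ r) := by
    refine integral_mono (int_cont (by fun_prop)) (int_cont (by fun_prop)) fun x => ?_
    have := hY 0 (|pderiv' j g x| ^ p) (|pderiv' j (pderiv' j g) x| ^ r)
      le_rfl (by positivity) (by positivity)
    rw [Real.rpow_zero, ← Real.rpow_mul (abs_nonneg _),
      ← Real.rpow_mul (abs_nonneg _), mul_one_div_cancel hr.ne',
      mul_div_cancel₀ _ (by linarith : p ≠ 0), Real.rpow_one] at this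
    simp only
    have hz : 0 ≤ (p - 1) * (|pderiv' j g x| ^ (p - 2) * |pderiv' j (pderiv' j g) x|) :=
      mul_nonneg (by linarith) (by positivity)
    have := mul_le_mul_of_nonneg_left (hb x) hz
    linarith
  rw [integral_add (int_cont (by fun_prop)) (int_cont (by fun_prop)),
    integral_const_mul, integral_div] at h2
  unfold Jp
  linarith

/-- sum over words of length `k` -/
noncomputable def Asum {d : ℕ} (m k : ℕ) (u : (Fin d → ℝ) → ℝ) : ℝ :=
  ∑ w : List.Vector (Fin d) k, Jp (2 * m / k) (Dw w.1 u)

lemma Asum_nonneg {d : ℕ} (m k : ℕ) (u : (Fin d → ℝ) → ℝ) : 0 ≤ Asum m k u :=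
  Finset.sum_nonneg fun _ _ => Jp_nonneg _ _

lemma le_Asum {d : ℕ} (m k : ℕ) (u : (Fin d → ℝ) → ℝ) (w : List (Fin d)) (hw : w.length = k) :
    Jp (2 * m / k) (Dw w u) ≤ Asum m k u :=
  Finset.single_le_sum (f := fun w : List.Vector (Fin d) k => Jp (2 * m / k) (Dw w.1 u))
    (fun _ _ => Jp_nonneg _ _) (Finset.mem_univ (α := List.Vector (Fin d) k) ⟨w, hw⟩)

lemma Asum_le {d : ℕ} (m k : ℕ) (u : (Fin d → ℝ) → ℝ) (X : ℝ)
    (h : ∀ w : List (Fin d), w.length = k → Jp (2 * m / k) (Dw w u) ≤ X) :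
    Asum m k u ≤ (d ^ k : ℕ) * X := by
  unfold Asum
  refine (Finset.sum_le_card_nsmul _ _ X fun w _ => h w.1 w.2).trans ?_
  rw [Finset.card_univ, card_vector, Fintype.card_fin, nsmul_eq_mul]

lemma chain1 (d m n : ℕ) (hn : n + 1 < m) :
    ∃ B : ℝ, 0 < B ∧ ∀ u : (Fin d → ℝ) → ℝ, SP u → (∀ x, |u x| ≤ 1) →
      Asum m (n + 1) u ≤ B * Asum m (n + 2) u := by
  induction n with
  | zero =>
    have hm : (1 : ℝ) < m := by exact_mod_cast hn
    obtain ⟨K, hK, h⟩ := stepB (p := 2 * m / (0 + 1 : ℕ)) (r := 2 * m / (0 + 2 : ℕ))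
      (by push_cast; linarith) (by push_cast; linarith)
      (by push_cast; field_simp; ring) d
    refine ⟨(d ^ (0 + 1) : ℕ) * (2 * K) + 1, by positivity, fun u hu hb => ?_⟩
    have := Asum_le m (0 + 1) u (2 * K * Asum m (0 + 2) u) ?_
    · have h0 := Asum_nonneg m (0 + 2) u
      nlinarith
    · intro w hw
      match w, hw with
      | [j], _ =>
        refine (h j u hu hb).trans ?_
        exact mul_le_mul_of_nonneg_left (le_Asum m (0 + 2) u [j, j] rfl) (by positivity)
  | succ n ih =>
    obtain ⟨B, hB, hI⟩ := ih (by omega)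
    have hm : (n : ℝ) + 2 < m := by
      have : ((n + 1 + 1 : ℕ) : ℝ) < m := by exact_mod_cast hn
      push_cast at this; linarith
    have hn0 : (0 : ℝ) ≤ n := Nat.cast_nonneg n
    set c : ℝ := ((d ^ (n + 1 + 1) : ℕ) : ℝ) with hc
    have hc0 : 0 ≤ c := Nat.cast_nonneg _
    obtain ⟨K, hK, h⟩ := stepA (p := 2 * m / (n + 1 + 1 : ℕ)) (s := 2 * m / (n + 1 : ℕ))
      (r := 2 * m / (n + 1 + 2 : ℕ)) (ε := 1 / (4 * (c + 1) * B))
      (by push_cast; rw [lt_div_iff₀ (by positivity)]; linarith)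
      (by have : (0 : ℝ) < m := by linarith
          positivity)
      (by have : (0 : ℝ) < m := by linarith
          positivity)
      (by have : (0 : ℝ) < m := by linarith
          push_cast; field_simp; ring) (by positivity) d
    refine ⟨4 * c * K + 1, by positivity, fun u hu hb => ?_⟩
    have h1 := Asum_le m (n + 1 + 1) u (2 * (1 / (4 * (c + 1) * B)) * Asum m (n + 1) u
      + 2 * K * Asum m (n + 1 + 2) u) ?_
    · have h0 := Asum_nonneg m (n + 1 + 2) u
      have h0' := Asum_nonneg m (n + 1 + 1) u
      have h2 := hI u hu hb
      have h3 : c * (2 * (1 / (4 * (c + 1) * B)) * Asum m (n + 1) u)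
          ≤ Asum m (n + 1 + 1) u / 2 := by
        calc _ ≤ c * (2 * (1 / (4 * (c + 1) * B)) * (B * Asum m (n + 2) u)) := by gcongr
          _ = (c / (c + 1)) * (Asum m (n + 1 + 1) u / 2) := by field_simp; ring
          _ ≤ 1 * (Asum m (n + 1 + 1) u / 2) := by
            gcongr
            rw [div_le_one (by positivity)]; linarith
          _ = _ := one_mul _
      rw [← hc, mul_add] at h1
      nlinarith
    · intro w hw
      match w, hw with
      | j :: w', hw =>
        have hw' : w'.length = n + 1 := by simpa using hw
        refine (h j (Dw w' u) (Dw_SP w' hu)).trans ?_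
        refine add_le_add ?_ ?_
        · exact mul_le_mul_of_nonneg_left (le_Asum m (n + 1) u w' hw') (by positivity)
        · exact mul_le_mul_of_nonneg_left
            (le_Asum m (n + 1 + 2) u (j :: j :: w') (by simp [hw'])) (by positivity)

lemma chain2 (d m t : ℕ) : ∀ n : ℕ, n + 1 + t = m →
    ∃ B : ℝ, 0 < B ∧ ∀ u : (Fin d → ℝ) → ℝ, SP u → (∀ x, |u x| ≤ 1) →
      Asum m (n + 1) u ≤ B * Asum m m u := by
  induction t with
  | zero =>
    intro n hn
    refine ⟨1, one_pos, fun u _ _ => ?_⟩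
    have : n + 1 = m := hn
    rw [this, one_mul]
  | succ t ih =>
    intro n hn
    obtain ⟨B, hB, h⟩ := ih (n + 1) (by omega)
    obtain ⟨B', hB', h'⟩ := chain1 d m n (by omega)
    refine ⟨B' * B, by positivity, fun u hu hb => ?_⟩
    refine (h' u hu hb).trans ?_
    rw [mul_assoc]
    exact mul_le_mul_of_nonneg_left (h u hu hb) hB'.le

lemma Asum_top {d m : ℕ} (hm : 0 < m) {u : (Fin d → ℝ) → ℝ} (hu : SP u) :
    Asum m m u ≤ (d ^ m : ℕ) * HkNorm d m u ^ 2 := by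
  refine Asum_le m m u _ fun w hw => ?_
  have hm' : (m : ℝ) ≠ 0 := by positivity
  rw [mul_div_cancel_right₀ _ hm']
  have : Jp 2 (Dw w u) = L2Norm d (Dw w u) ^ 2 := by
    rw [L2_sq]
    unfold Jp
    simp
  rw [this, Dw_eq_mderiv w hu]
  refine L2_le_Hk _ ?_ u
  rw [← hw, ← wordOf_length]
  refine le_of_eq (List.Perm.length_eq ?_)
  rw [List.perm_iff_count]
  intro a
  rw [count_wordOf]

/-- interpolation bound for normalized functions -/
lemma interp (d m : ℕ) (k : ℕ) (hk : 0 < k) (hkm : k ≤ m) :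
    ∃ B : ℝ, 0 < B ∧ ∀ u : (Fin d → ℝ) → ℝ, SP u → (∀ x, |u x| ≤ 1) →
      ∀ w : List (Fin d), w.length = k → Jp (2 * m / k) (Dw w u) ≤ B * HkNorm d m u ^ 2 := by
  obtain ⟨n, rfl⟩ : ∃ n, k = n + 1 := ⟨k - 1, by omega⟩
  obtain ⟨B, hB, h⟩ := chain2 d m (m - (n + 1)) n (by omega)
  refine ⟨B * (d ^ m : ℕ) + 1, by positivity, fun u hu hb w hw => ?_⟩
  have h1 := (le_Asum m (n + 1) u w hw).trans (h u hu hb)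
  have h2 := mul_le_mul_of_nonneg_left (Asum_top (by omega : 0 < m) hu) hB.le
  nlinarith [sq_nonneg (HkNorm d m u)]

lemma L2_nonneg {d : ℕ} (f : (Fin d → ℝ) → ℝ) : 0 ≤ L2Norm d f := Real.sqrt_nonneg _

lemma Hk_nonneg {d k : ℕ} (f : (Fin d → ℝ) → ℝ) : 0 ≤ HkNorm d k f := Real.sqrt_nonneg _

lemma L2_const_mul {d : ℕ} {c : ℝ} (hc : 0 ≤ c) (f : (Fin d → ℝ) → ℝ) :
    L2Norm d (fun x => c * f x) = c * L2Norm d f := by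
  unfold L2Norm
  simp only [mul_pow]
  rw [integral_const_mul, Real.sqrt_mul (sq_nonneg c), Real.sqrt_sq hc]

lemma Hk_const_mul {d k : ℕ} {c : ℝ} (hc : 0 ≤ c) {f : (Fin d → ℝ) → ℝ} (hf : SP f) :
    HkNorm d k (fun x => c * f x) = c * HkNorm d k f := by
  unfold HkNorm
  have : ∀ α : Fin d → ℕ, L2Norm d (mderiv α (fun x => c * f x)) ^ 2
      = c ^ 2 * L2Norm d (mderiv α f) ^ 2 := by
    intro α
    rw [mderiv_eq, mderiv_eq, Dw_const_mul _ _ hf, L2_const_mul hc, mul_pow]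
  simp only [this]
  rw [← Finset.mul_sum, Real.sqrt_mul (sq_nonneg c), Real.sqrt_sq hc]

lemma normalized (d m k : ℕ) (hk : 0 < k) (hkm : k < m) :
    ∃ C : ℝ, 0 < C ∧ ∀ u v : (Fin d → ℝ) → ℝ, SP u → SP v →
      (∀ x, |u x| ≤ 1) → (∀ x, |v x| ≤ 1) →
      ∀ a b : List (Fin d), a.length = k → b.length = m - k →
        L2Norm d (fun x => Dw a u x * Dw b v x) ≤ C * (HkNorm d m v + HkNorm d m u) := by
  obtain ⟨B, hB, h⟩ := interp d m k hk hkm.le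
  obtain ⟨B', hB', h'⟩ := interp d m (m - k) (by omega) (by omega)
  refine ⟨B + B' + 1, by positivity, fun u v hu hv hub hvb a b ha hb => ?_⟩
  have h1 := h u hu hub a ha
  have h2 := h' v hv hvb b hb
  have hk0 : (0 : ℝ) < k := by exact_mod_cast hk
  have hkm0 : (k : ℝ) < m := by exact_mod_cast hkm
  have hcast : ((m - k : ℕ) : ℝ) = m - k := by push_cast [hkm.le]; ring
  rw [hcast] at h2
  have hl0 : (0 : ℝ) < m - k := by linarith
  have hm0 : (0 : ℝ) < m := by linarith
  have hU := Dw_SP a hu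
  have hV := Dw_SP b hv
  have cU := cont_abs_rpow hU (q := 2 * m / k) (by positivity)
  have cV := cont_abs_rpow hV (q := 2 * m / (m - k)) (by positivity)
  have bU := hU.1.continuous
  have bV := hV.1.continuous
  have key : L2Norm d (fun x => Dw a u x * Dw b v x) ^ 2
      ≤ Jp (2 * m / k) (Dw a u) + Jp (2 * m / (m - k)) (Dw b v) := by
    rw [L2_sq]
    unfold Jp
    rw [← integral_add (int_cont cU) (int_cont cV)]
    refine integral_mono (int_cont (by fun_prop)) (int_cont (by fun_prop)) fun x => ?_
    have hy := Real.geom_mean_le_arith_mean2_weighted (w₁ := k / m) (w₂ := (m - k) / m)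
      (p₁ := |Dw a u x| ^ (2 * m / k : ℝ)) (p₂ := |Dw b v x| ^ (2 * m / (m - k) : ℝ))
      (by positivity) (by positivity) (by positivity) (by positivity) (by field_simp; ring)
    rw [← Real.rpow_mul (abs_nonneg _), ← Real.rpow_mul (abs_nonneg _),
      show (2 * m / k : ℝ) * (k / m) = 2 by field_simp,
      show (2 * m / (m - k) : ℝ) * ((m - k) / m) = 2 by field_simp,
      Real.rpow_two, Real.rpow_two, sq_abs, sq_abs] at hy
    simp only [mul_pow]
    refine hy.trans (add_le_add ?_ ?_)
    · exact mul_le_of_le_one_left (by positivity) (by rw [div_le_one hm0]; linarith)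
    · exact mul_le_of_le_one_left (by positivity) (by rw [div_le_one hm0]; linarith)
  have nu := Hk_nonneg (k := m) u
  have nv := Hk_nonneg (k := m) v
  refine le_of_sq_le_sq ?_ (by positivity)
  calc _ ≤ B * HkNorm d m u ^ 2 + B' * HkNorm d m v ^ 2 := by linarith
    _ ≤ (B + B' + 1) * HkNorm d m u ^ 2 + (B + B' + 1) * HkNorm d m v ^ 2 := by
      gcongr <;> linarith
    _ ≤ (B + B' + 1) * (HkNorm d m v + HkNorm d m u) ^ 2 := by
      nlinarith [mul_nonneg (mul_nonneg nu nv) (by positivity : 0 ≤ B + B' + 1)]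
    _ ≤ (B + B' + 1) ^ 2 * (HkNorm d m v + HkNorm d m u) ^ 2 := by
      gcongr
      nlinarith
    _ = _ := by ring

lemma Linf_nonneg {d : ℕ} (f : (Fin d → ℝ) → ℝ) : 0 ≤ LinfNorm d f :=
  Real.iSup_nonneg fun _ => abs_nonneg _

lemma L2_mul_le {d : ℕ} {f g : (Fin d → ℝ) → ℝ} (hf : SP f) (hg : SP g) :
    L2Norm d (fun x => f x * g x) ≤ LinfNorm d f * L2Norm d g := by
  have n1 := Linf_nonneg f
  rw [← L2_const_mul n1]
  unfold L2Norm
  have b1 := hf.1.continuous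
  have b2 := hg.1.continuous
  refine Real.sqrt_le_sqrt (integral_mono (int_cont (by fun_prop)) (int_cont (by fun_prop))
    fun x => ?_)
  simp only [mul_pow]
  refine mul_le_mul_of_nonneg_right ?_ (sq_nonneg _)
  rw [← sq_abs]
  exact pow_le_pow_left₀ (abs_nonneg _) (le_Linf hf x) 2

lemma SP_const_mul {d : ℕ} (c : ℝ) {f : (Fin d → ℝ) → ℝ} (hf : SP f) : SP (fun x => c * f x) :=
  ⟨contDiff_const.mul hf.1, fun x v => by simp only [hf.2 x v]⟩

lemma main_k (d m k : ℕ) :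
    ∃ C : ℝ, 0 < C ∧ ∀ u v : (Fin d → ℝ) → ℝ, SP u → SP v →
      ∀ α β : Fin d → ℕ, ∑ i, α i = k → (∑ i, α i) + (∑ i, β i) = m →
        L2Norm d (fun x => mderiv α u x * mderiv β v x)
          ≤ C * (LinfNorm d u * HkNorm d m v + HkNorm d m u * LinfNorm d v) := by
  have nl : ∀ γ : Fin d → ℕ, ∑ i, γ i = 0 → ∀ f : (Fin d → ℝ) → ℝ, mderiv γ f = f := by
    intro γ h f
    rw [← wordOf_length, List.length_eq_zero_iff] at h
    rw [mderiv_eq, h]; rfl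
  have le1 : ∀ γ : Fin d → ℕ, ∑ i, γ i ≤ m → ∀ f, L2Norm d (mderiv γ f) ≤ HkNorm d m f :=
    fun γ h f => le_of_sq_le_sq (L2_le_Hk γ h f) (Hk_nonneg f)
  rcases Nat.eq_zero_or_pos k with hk | hk
  · refine ⟨1, one_pos, fun u v hu hv α β hα hm => ?_⟩
    rw [nl α (hα.trans hk) u, one_mul]
    have h1 := L2_mul_le hu (g := mderiv β v) (by rw [mderiv_eq]; exact Dw_SP _ hv)
    have h2 := mul_le_mul_of_nonneg_left (le1 β (by omega) v) (Linf_nonneg u)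
    have h3 := mul_nonneg (Hk_nonneg (k := m) u) (Linf_nonneg v)
    linarith
  rcases lt_or_ge k m with hkm | hkm
  · obtain ⟨C, hC, h⟩ := normalized d m k hk hkm
    refine ⟨C, hC, fun u v hu hv α β hα hm => ?_⟩
    have h0 : 0 ≤ C * (LinfNorm d u * HkNorm d m v + HkNorm d m u * LinfNorm d v) :=
      mul_nonneg hC.le (add_nonneg (mul_nonneg (Linf_nonneg _) (Hk_nonneg _))
        (mul_nonneg (Hk_nonneg _) (Linf_nonneg _)))
    have zero : ∀ f : (Fin d → ℝ) → ℝ, SP f → LinfNorm d f = 0 →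
        ∀ γ : Fin d → ℕ, ∀ x, mderiv γ f x = 0 := by
      intro f hf h0 γ x
      have e : f = fun x => 0 * f x := by
        funext y
        have := le_Linf hf y
        rw [h0] at this
        rw [zero_mul]
        exact abs_nonpos_iff.1 this
      rw [mderiv_eq, e, Dw_const_mul _ _ hf]
      exact zero_mul _
    rcases (Linf_nonneg u).eq_or_lt' with hu0 | hu0
    · simp only [zero u hu hu0, zero_mul]
      refine le_trans (le_of_eq ?_) h0
      simp [L2Norm]
    rcases (Linf_nonneg v).eq_or_lt' with hv0 | hv0
    · simp only [zero v hv hv0, mul_zero]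
      refine le_trans (le_of_eq ?_) h0
      simp [L2Norm]
    have nb : ∀ f : (Fin d → ℝ) → ℝ, SP f → 0 < LinfNorm d f →
        ∀ x, |(LinfNorm d f)⁻¹ * f x| ≤ 1 := by
      intro f hf h0 x
      rw [abs_mul, abs_of_pos (inv_pos.2 h0), inv_mul_le_one₀ h0]
      exact le_Linf hf x
    have := h _ _ (SP_const_mul (LinfNorm d u)⁻¹ hu) (SP_const_mul (LinfNorm d v)⁻¹ hv)
      (nb u hu hu0) (nb v hv hv0) (wordOf α) (wordOf β) (by rw [wordOf_length, hα])
      (by rw [wordOf_length]; omega)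
    rw [Dw_const_mul _ _ hu, Dw_const_mul _ _ hv, Hk_const_mul (by positivity) hu,
      Hk_const_mul (by positivity) hv] at this
    have e : (fun x => (LinfNorm d u)⁻¹ * Dw (wordOf α) u x
        * ((LinfNorm d v)⁻¹ * Dw (wordOf β) v x))
      = fun x => ((LinfNorm d u)⁻¹ * (LinfNorm d v)⁻¹) * (mderiv α u x * mderiv β v x) := by
      funext x
      rw [mderiv_eq, mderiv_eq]; ring
    rw [e, L2_const_mul (by positivity)] at this
    have h4 := mul_le_mul_of_nonneg_left this (mul_pos hu0 hv0).le
    refine le_trans (le_of_eq ?_) (h4.trans (le_of_eq ?_))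
    · field_simp
    · field_simp
  · refine ⟨1, one_pos, fun u v hu hv α β hα hm => ?_⟩
    rw [nl β (by omega) v, one_mul]
    have h1 := L2_mul_le hv (g := mderiv α u) (by rw [mderiv_eq]; exact Dw_SP _ hu)
    have h2 := mul_le_mul_of_nonneg_left (le1 α (by omega) u) (Linf_nonneg v)
    have h3 := mul_nonneg (Linf_nonneg u) (Hk_nonneg (k := m) v)
    simp only [mul_comm (v _)] at h1
    linarith

/-- Moser-type product estimate: for `|α| + |β| = m`,
`‖(∂^α u)(∂^β v)‖_{L²} ≤ C (‖u‖_{L^∞} ‖v‖_{H^m} + ‖u‖_{H^m} ‖v‖_{L^∞})`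
with `C` depending only on `m` and `d`. -/
theorem stmt5 (d m : ℕ) :
    ∃ C : ℝ, 0 < C ∧ ∀ u v : (Fin d → ℝ) → ℝ,
      ContDiff ℝ (⊤ : ℕ∞) u → ContDiff ℝ (⊤ : ℕ∞) v → TorusPeriodic u → TorusPeriodic v →
      ∀ α β : Fin d → ℕ, (∑ i, α i) + (∑ i, β i) = m →
        L2Norm d (fun x => mderiv α u x * mderiv β v x)
          ≤ C * (LinfNorm d u * HkNorm d m v + HkNorm d m u * LinfNorm d v) := by

  choose C hC h using main_k d m
  refine ⟨∑ k ∈ Finset.range (m + 1), C k,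
    Finset.sum_pos (fun k _ => hC k) ⟨0, by simp⟩, fun u v hu hv pu pv α β hm => ?_⟩
  refine (h (∑ i, α i) u v ⟨hu, pu⟩ ⟨hv, pv⟩ α β rfl hm).trans ?_
  refine mul_le_mul_of_nonneg_right ?_ (add_nonneg (mul_nonneg (Linf_nonneg _) (Hk_nonneg _))
        (mul_nonneg (Hk_nonneg _) (Linf_nonneg _)))
  exact Finset.single_le_sum (fun k _ => (hC k).le) (Finset.mem_range.2 (by omega))
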